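/- For each integer m ≥ 0 let A_m ⊆ A denote the image in A of the ℂ-subspace of ℂ[x_1,…,x_N] consisting of weighted homogeneous polynomials of degree m (each A_m is finite-dimensional). Then the following identity of formal power series holds in ℤ[[t]]: (Σ_{m ≥ 0} dim_ℂ(A_m)·t^m) · Π_{j=1}^{N}(1 − t^{w_j}) = Π_{i=1}^{N}(1 − t^{e_i}). In particular, the rational function Π_i(1 − t^{e_i}) / Π_j(1 − t^{w_j}) is a polynomial with nonnegative integer coefficients. -/

import Mathlib

/-- `A_m`: the image in `A = ℂ[x]/(f₁,…,f_N)` of the subspace of weighted homogeneous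
polynomials of weighted degree `m`. -/
noncomputable def gradedPiece (N : ℕ) (w : Fin N → ℕ) (f : Fin N → MvPolynomial (Fin N) ℂ)
    (m : ℕ) :
    Submodule ℂ (MvPolynomial (Fin N) ℂ ⧸ Ideal.span (Set.range f)) :=
  Submodule.map (Ideal.Quotient.mkₐ ℂ (Ideal.span (Set.range f))).toLinearMap
    (MvPolynomial.weightedHomogeneousSubmodule ℂ w m)

section LocalDepth

open RingTheory.Sequence CategoryTheory Abelian IsLocalRing Pointwise

universe u

variable {R : Type u} [CommRing R]

/-- If `x` lies in the maximal ideal, is regular on `K`, and `Ext^{i+1}(K/xK, M) = 0`, then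
`Ext^i(K, M) = 0`. -/
lemma subsingleton_ext_of_subsingleton_ext_quotSMulTop [IsNoetherianRing R] [IsLocalRing R]
    (K M : ModuleCat.{u} R) [Module.Finite R K] [Module.Finite R M] {x : R}
    (reg : IsSMulRegular K x) (mem : x ∈ maximalIdeal R) (i : ℕ)
    (zero : Subsingleton (Ext (ModuleCat.of R (QuotSMulTop x K)) M (i + 1))) :
    Subsingleton (Ext K M i) := by
  have exac := Ext.contravariant_sequence_exact₁' reg.smulShortComplex_shortExact M i (i + 1)
    (add_comm 1 i)
  have epi := exac.epi_f ((@AddCommGrpCat.isZero_of_subsingleton _ zero).eq_zero_of_tgt _)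
  have h_smul : (K.smulShortComplex x).f = x • 𝟙 K := rfl
  simp only [h_smul, AddCommGrpCat.epi_iff_surjective, AddCommGrpCat.hom_ofHom] at epi
  by_contra! ntr
  have : x ∈ (Module.annihilator R (Ext K M i)).jacobson :=
    (IsLocalRing.maximalIdeal_le_jacobson _) mem
  absurd Submodule.top_ne_pointwise_smul_of_mem_jacobson_annihilator this
  rw [eq_comm, eq_top_iff]
  intro y hy
  obtain ⟨z, hz⟩ : ∃ z : Ext K M i, (Ext.mk₀ (x • 𝟙 K)).comp z (zero_add i) = y := epi y
  rw [Ext.mk₀_smul, Ext.smul_comp, Ext.mk₀_id_comp] at hz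
  rw [← hz]
  exact Submodule.smul_mem_pointwise_smul z x ⊤ trivial

/-- A form of Ischebeck's vanishing theorem: if `Ext^i(K, M) = 0` for `i < n` whenever `K` is
supported at the closed point, then `Ext^i(K, M) = 0` for `i + r < n` whenever `r` elements of the
maximal ideal cut the support of `K` down to the closed point. -/
lemma subsingleton_ext_of_maximalIdeal_le_radical [IsNoetherianRing R] [IsLocalRing R]
    (M : ModuleCat.{u} R)
    [Module.Finite R M] (n : ℕ)
    (h_depth : ∀ K : ModuleCat.{u} R, Module.Finite R K →
      maximalIdeal R ≤ (Module.annihilator R K).radical → ∀ i < n, Subsingleton (Ext K M i))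
    (gs : List R) (h_mem : ∀ g ∈ gs, g ∈ maximalIdeal R) (K : ModuleCat.{u} R) [Module.Finite R K]
    (hK : maximalIdeal R ≤ (Module.annihilator R K ⊔ Ideal.ofList gs).radical)
    (i : ℕ) (hi : i + gs.length < n) : Subsingleton (Ext K M i) := by
  induction gs generalizing K i with
  | nil => exact h_depth K inferInstance (by simpa using hK) i (by simpa using hi)
  | cons g gs ih =>
    simp only [List.mem_cons, forall_eq_or_imp] at h_mem
    simp only [List.length_cons] at hi
    let φ : Module.End R K := LinearMap.lsmul R K g
    have φ_pow (k : ℕ) (y : K) : (φ ^ k) y = g ^ k • y := by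
      induction k generalizing y with
      | zero => simp
      | succ k ihk => rw [pow_succ, Module.End.mul_apply, ihk, pow_succ, mul_smul]; rfl
    obtain ⟨k, hk⟩ := monotone_stabilizes_iff_noetherian.mpr (inferInstance : IsNoetherian R K)
      ⟨fun k ↦ LinearMap.ker (φ ^ k), monotone_nat_of_le_succ fun k ↦ by
        rw [pow_succ', Module.End.mul_eq_comp]; exact LinearMap.ker_le_ker_comp _ _⟩
    let T : Submodule R K := LinearMap.ker (φ ^ k)
    have hT (y : K) : y ∈ T ↔ g ^ k • y = 0 := by rw [LinearMap.mem_ker, φ_pow]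
    have hT' (y : K) : y ∈ T ↔ g ^ (k + 1) • y = 0 := by
      rw [← φ_pow, ← LinearMap.mem_ker]
      exact (SetLike.ext_iff.mp (hk (k + 1) k.le_succ) y)
    have reg : IsSMulRegular (K ⧸ T) g := by
      rw [isSMulRegular_iff_right_eq_zero_of_smul]
      intro y hy
      induction y using Submodule.Quotient.induction_on with | _ y
      rw [← Submodule.Quotient.mk_smul, Submodule.Quotient.mk_eq_zero, hT, ← mul_smul,
        ← pow_succ, ← hT'] at hy
      rwa [Submodule.Quotient.mk_eq_zero]
    have extT : Subsingleton (Ext (ModuleCat.of R T) M i) := by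
      refine ih h_mem.2 (ModuleCat.of R T) (hK.trans ?_) i (by omega)
      rw [Ideal.radical_le_radical_iff, Ideal.ofList_cons]
      refine sup_le ?_ (sup_le ?_ ?_)
      · exact ((LinearMap.annihilator_le_of_injective T.subtype T.injective_subtype).trans
          le_sup_left).trans Ideal.le_radical
      · rw [Ideal.span_singleton_le_iff_mem]
        refine ⟨k, Ideal.mem_sup_left (Module.mem_annihilator.mpr fun y ↦ ?_)⟩
        exact Subtype.ext ((hT y).mp y.2)
      · exact le_sup_right.trans Ideal.le_radical
    have extQ : Subsingleton (Ext (ModuleCat.of R (K ⧸ T)) M i) := by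
      refine subsingleton_ext_of_subsingleton_ext_quotSMulTop (ModuleCat.of R (K ⧸ T)) M reg
        h_mem.1 i (ih h_mem.2 _ (hK.trans (Ideal.radical_mono ?_)) (i + 1) (by omega))
      rw [Ideal.ofList_cons, ← sup_assoc]
      refine sup_le_sup_right (sup_le ?_ ?_) _
      · exact (LinearMap.annihilator_le_of_surjective T.mkQ T.mkQ_surjective).trans
          (LinearMap.annihilator_le_of_surjective _ (Submodule.mkQ_surjective _))
      · rw [Ideal.span_singleton_le_iff_mem]
        exact QuotSMulTop.mem_annihilator _ _
    have hS := LinearMap.shortExact_shortComplexKer T.mkQ_surjective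
    have ext_ker : Subsingleton (Ext (ModuleCat.of R (LinearMap.ker T.mkQ)) M i) := by
      rwa [Submodule.ker_mkQ]
    exact AddCommGrpCat.subsingleton_of_isZero <| ShortComplex.Exact.isZero_of_both_zeros
      (Ext.contravariant_sequence_exact₂' hS M i)
      ((@AddCommGrpCat.isZero_of_subsingleton _ extQ).eq_zero_of_src _)
      ((@AddCommGrpCat.isZero_of_subsingleton _ ext_ker).eq_zero_of_tgt _)

lemma subsingleton_linearMap_quotient_of_isWeaklyRegular (K : ModuleCat.{u} R) (rs : List R)
    (M : ModuleCat.{u} R) (reg : IsWeaklyRegular M rs)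
    (h_ext : ∀ i ≤ rs.length, Subsingleton (Ext K M i)) :
    Subsingleton (K →ₗ[R] (M ⧸ (Ideal.ofList rs • ⊤ : Submodule R M))) := by
  induction rs generalizing M with
  | nil =>
    have : Subsingleton (K →ₗ[R] M) :=
      (Ext.addEquiv₀.trans ModuleCat.homAddEquiv).symm.subsingleton_congr.mpr (h_ext 0 le_rfl)
    have e : (M ⧸ (Ideal.ofList ([] : List R) • ⊤ : Submodule R M)) ≃ₗ[R] M :=
      Submodule.quotEquivOfEqBot _ (by simp)
    exact (LinearEquiv.congrRight e).toEquiv.subsingleton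
  | cons r rs ih =>
    rw [isWeaklyRegular_cons_iff] at reg
    have := ih (ModuleCat.of R (QuotSMulTop r M)) reg.2 fun i hi ↦ by
      have zero1 := AddCommGrpCat.isZero_of_iff_subsingleton.mpr
        (h_ext i (hi.trans (Nat.le_succ _)))
      have zero2 := AddCommGrpCat.isZero_of_iff_subsingleton.mpr
        (h_ext (i + 1) (Nat.succ_le_succ hi))
      exact AddCommGrpCat.subsingleton_of_isZero <| ShortComplex.Exact.isZero_of_both_zeros
        ((Ext.covariant_sequence_exact₃' K reg.1.smulShortComplex_shortExact) i (i + 1) rfl)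
        (zero1.eq_zero_of_src _) (zero2.eq_zero_of_tgt _)
    exact (LinearEquiv.congrRight
      (Submodule.quotOfListConsSMulTopEquivQuotSMulTopInner M r rs)).toEquiv.subsingleton

/-- A system of parameters in a Cohen–Macaulay local ring is a regular sequence. Here
Cohen–Macaulayness is witnessed by a regular sequence `xs` of the same length as the system of
parameters. -/
lemma isWeaklyRegular_of_maximalIdeal_le_radical [IsNoetherianRing R] [IsLocalRing R]
    (xs : List R)
    (h_xs : ∀ x ∈ xs, x ∈ maximalIdeal R) (reg_xs : IsRegular R xs) (rs gs : List R)
    (h_rs : IsWeaklyRegular R rs) (h_gs : ∀ g ∈ gs, g ∈ maximalIdeal R)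
    (h_rad : maximalIdeal R ≤ (Ideal.ofList (rs ++ gs)).radical)
    (h_len : (rs ++ gs).length ≤ xs.length) : IsWeaklyRegular R (rs ++ gs) := by
  induction gs generalizing rs with
  | nil => simpa using h_rs
  | cons g gs ih =>
    simp only [List.mem_cons, forall_eq_or_imp] at h_gs
    suffices IsWeaklyRegular R (rs ++ [g]) by
      simpa using ih (rs ++ [g]) this h_gs.2 (by simpa using h_rad) (by simpa using h_len)
    rw [isWeaklyRegular_append_iff, isWeaklyRegular_singleton_iff,
      isSMulRegular_iff_right_eq_zero_of_smul]
    refine ⟨h_rs, fun u hu ↦ ?_⟩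
    let Q := R ⧸ (Ideal.ofList rs • ⊤ : Submodule R R)
    let K : Submodule R Q := LinearMap.ker (LinearMap.lsmul R Q g)
    have h_ann : maximalIdeal R ≤ (Module.annihilator R K ⊔ Ideal.ofList gs).radical := by
      refine h_rad.trans (Ideal.radical_mono ?_)
      rw [Ideal.ofList_append, Ideal.ofList_cons, ← sup_assoc]
      refine sup_le_sup_right (sup_le (fun r hr ↦ ?_) ?_) _
      · have h_annQ : r ∈ Module.annihilator R Q := by
          rw [Module.mem_annihilator]
          intro y
          induction y using Submodule.Quotient.induction_on with | _ y
          rw [← Submodule.Quotient.mk_smul, Submodule.Quotient.mk_eq_zero]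
          exact Submodule.smul_mem_smul hr trivial
        exact LinearMap.annihilator_le_of_injective K.subtype K.injective_subtype h_annQ
      · rw [Ideal.span_singleton_le_iff_mem, Module.mem_annihilator]
        exact fun y ↦ Subtype.ext y.2
    have h_depth (L : ModuleCat.{u} R) (_ : Module.Finite R L)
        (hL : maximalIdeal R ≤ (Module.annihilator R L).radical) :
        ∀ i < xs.length, Subsingleton (Ext L (ModuleCat.of R R) i) := by
      refine ModuleCat.subsingleton_ext_of_exists_isRegular (maximalIdeal R) L ?_
        (ModuleCat.of R R) ?_ xs h_xs reg_xs
      · rwa [Module.support_eq_zeroLocus, PrimeSpectrum.zeroLocus_subset_zeroLocus_iff]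
      · simpa using (maximalIdeal.isMaximal R).ne_top.lt_top
    have := subsingleton_linearMap_quotient_of_isWeaklyRegular (ModuleCat.of R K) rs
      (ModuleCat.of R R) h_rs fun i hi ↦
        subsingleton_ext_of_maximalIdeal_le_radical (ModuleCat.of R R) xs.length h_depth gs h_gs.2
          (ModuleCat.of R K) h_ann i (by simp at h_len; omega)
    have h_sub : K.subtype = 0 := this.elim _ _
    exact LinearMap.congr_fun h_sub ⟨u, hu⟩

end LocalDepth

namespace MvPolynomial

open RingTheory.Sequence

variable {σ k : Type*} [Field k] {w : σ → ℕ}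

attribute [local instance] weightedGradedAlgebra

lemma IsWeightedHomogeneous.weightedHomogeneousComponent_mul {g : MvPolynomial σ k} {e : ℕ}
    (hg : g.IsWeightedHomogeneous w e) (p : MvPolynomial σ k) (m : ℕ) :
    weightedHomogeneousComponent w m (g * p) =
      if e ≤ m then g * weightedHomogeneousComponent w (m - e) p else 0 := by
  have := DirectSum.coe_decompose_mul_of_left_mem (weightedHomogeneousSubmodule k w) (b := p) m hg
  have decompose_eq (q : MvPolynomial σ k) (i : ℕ) :
      (DirectSum.decompose (weightedHomogeneousSubmodule k w) q i : MvPolynomial σ k) =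
        weightedHomogeneousComponent w i q := decompose'_apply k w q i
  simpa only [decompose_eq] using this

/-- The ideal `I` contains the weighted homogeneous components of its elements. -/
def IsWeightedHomogeneousIdeal (w : σ → ℕ) (I : Ideal (MvPolynomial σ k)) : Prop :=
  ∀ m, ∀ p ∈ I, weightedHomogeneousComponent w m p ∈ I

lemma isWeightedHomogeneousIdeal_span {S : Set (MvPolynomial σ k)}
    (hS : ∀ g ∈ S, ∃ e, g.IsWeightedHomogeneous w e) :
    IsWeightedHomogeneousIdeal w (Ideal.span S) := by
  intro m p hp
  exact weightedHomogeneousComponent_mem_of_mem k w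
    (Ideal.homogeneous_span (weightedHomogeneousSubmodule k w) S hS) hp m

/-- A weighted homogeneous ideal is saturated with respect to the elements outside the ideal of
the origin. -/
lemma IsWeightedHomogeneousIdeal.mem_of_mul_mem {I : Ideal (MvPolynomial σ k)}
    (hI : IsWeightedHomogeneousIdeal w I) (hw : ∀ j, 0 < w j) {s u : MvPolynomial σ k}
    (hs : constantCoeff s ≠ 0) (h : s * u ∈ I) : u ∈ I := by
  have key (d : ℕ) : weightedHomogeneousComponent w d u ∈ I := by
    induction d using Nat.strong_induction_on with | _ d ih
    have h_zero : weightedHomogeneousComponent w 0 s = C (constantCoeff s) := by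
      rw [constantCoeff_eq]
      exact weightedHomogeneousComponent_zero s (fun j ↦ (hw j).ne')
    have h_rest : weightedHomogeneousComponent w d
        ((s - weightedHomogeneousComponent w 0 s) * u) ∈ I := by
      have h_fin := weightedHomogeneousComponent_finsupp (w := w) s
      have h_sum : s = ∑ i ∈ h_fin.toFinset, weightedHomogeneousComponent w i s := by
        conv_lhs => rw [← sum_weightedHomogeneousComponent w s]
        exact finsum_eq_sum _ h_fin
      have h_sub : s - weightedHomogeneousComponent w 0 s =
          ∑ i ∈ h_fin.toFinset.erase 0, weightedHomogeneousComponent w i s := by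
        rw [sub_eq_iff_eq_add]
        have h0 : 0 ∈ h_fin.toFinset := (Set.Finite.mem_toFinset h_fin).mpr <| by
          change weightedHomogeneousComponent w 0 s ≠ 0
          rw [h_zero]
          exact (map_ne_zero_iff C (C_injective _ _)).mpr hs
        rw [Finset.sum_erase_add _ _ h0, ← h_sum]
      rw [h_sub, Finset.sum_mul, map_sum]
      refine Ideal.sum_mem _ fun i hi ↦ ?_
      rw [(weightedHomogeneousComponent_isWeightedHomogeneous i s).weightedHomogeneousComponent_mul]
      have hi0 : i ≠ 0 := Finset.ne_of_mem_erase hi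
      split_ifs with hid
      · exact I.mul_mem_left _ (ih _ (by omega))
      · exact I.zero_mem
    have h_all := I.sub_mem (hI d _ h) h_rest
    rw [← map_sub, sub_mul, sub_sub_cancel, h_zero, C_mul', map_smul, smul_eq_C_mul] at h_all
    have := I.mul_mem_left (C (constantCoeff s)⁻¹) h_all
    rwa [← mul_assoc, ← C_mul, inv_mul_cancel₀ hs, C_1, one_mul] at this
  rw [← sum_weightedHomogeneousComponent w u,
    finsum_eq_sum _ (weightedHomogeneousComponent_finsupp u)]
  exact Ideal.sum_mem _ fun i _ ↦ key i

/-- In a finite-dimensional weighted homogeneous quotient the variables are nilpotent. -/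
lemma IsWeightedHomogeneousIdeal.exists_X_pow_mem {I : Ideal (MvPolynomial σ k)}
    (hI : IsWeightedHomogeneousIdeal w I) (hw : ∀ j, 0 < w j)
    [FiniteDimensional k (MvPolynomial σ k ⧸ I)] (j : σ) :
    ∃ n, (X j : MvPolynomial σ k) ^ n ∈ I := by
  obtain ⟨q, q_monic, hq⟩ := Algebra.IsIntegral.isIntegral (R := k) (Ideal.Quotient.mk I (X j))
  refine ⟨q.natDegree, ?_⟩
  have h_mem : Polynomial.aeval (X j : MvPolynomial σ k) q ∈ I := by
    rw [← Ideal.Quotient.eq_zero_iff_mem, ← Ideal.Quotient.mkₐ_eq_mk k I,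
      ← Polynomial.aeval_algHom_apply]
    exact hq
  have h_comp := hI (q.natDegree * w j) _ h_mem
  rw [Polynomial.aeval_eq_sum_range, map_sum, Finset.sum_eq_single q.natDegree] at h_comp
  · have h_hom := (isWeightedHomogeneous_X k w j).pow q.natDegree
    rw [smul_eq_mul] at h_hom
    rwa [map_smul, h_hom.weightedHomogeneousComponent_same, Polynomial.coeff_natDegree,
      q_monic.leadingCoeff, one_smul] at h_comp
  · intro i _ hi
    rw [map_smul, ((isWeightedHomogeneous_X k w j).pow i).weightedHomogeneousComponent_ne,
      smul_zero]
    rw [smul_eq_mul]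
    exact fun h ↦ hi (Nat.eq_of_mul_eq_mul_right (hw j) h.symm)
  · simp

lemma isWeaklyRegular_X {N : ℕ} :
    IsWeaklyRegular (MvPolynomial (Fin N) k)
    ((List.finRange N).map X : List (MvPolynomial (Fin N) k)) := by
  refine ⟨fun i hi ↦ ?_⟩
  have h_ideal : (Ideal.ofList (((List.finRange N).map X).take i) : Ideal (MvPolynomial (Fin N) k))
      = Ideal.span (X '' {j : Fin N | (j : ℕ) < i}) := by
    refine congrArg Ideal.span (Set.ext fun p ↦ ?_)
    change p ∈ List.take i _ ↔ ∃ j : Fin N, (j : ℕ) < i ∧ X j = p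
    simp only [List.mem_take_iff_getElem, List.getElem_map, List.getElem_finRange]
    simp only [List.length_map, List.length_finRange] at hi
    constructor
    · rintro ⟨j, hj, rfl⟩
      exact ⟨_, lt_of_lt_of_le hj (min_le_left _ _), rfl⟩
    · rintro ⟨j, hj, rfl⟩
      exact ⟨j, by simpa using hj, rfl⟩
  rw [isSMulRegular_iff_right_eq_zero_of_smul]
  intro p hp
  induction p using Submodule.Quotient.induction_on with | _ p
  rw [← Submodule.Quotient.mk_smul, Submodule.Quotient.mk_eq_zero] at hp
  rw [Submodule.Quotient.mk_eq_zero]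
  simp only [smul_eq_mul, Ideal.mul_top, List.getElem_map, List.getElem_finRange, h_ideal,
    mem_ideal_span_X_image] at hp ⊢
  intro a ha
  obtain ⟨j, hj, hja⟩ := hp (Finsupp.single _ 1 + a) (by
    rw [mem_support_iff, coeff_X_mul]; exact mem_support_iff.mp ha)
  refine ⟨j, hj, ?_⟩
  rw [Finsupp.add_apply, Finsupp.single_eq_of_ne, zero_add] at hja
  · exact hja
  · rintro rfl
    simp at hj

lemma mem_span_range_X_iff {p : MvPolynomial σ k} :
    p ∈ Ideal.span (Set.range (X : σ → MvPolynomial σ k)) ↔ constantCoeff p = 0 := by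
  rw [← Set.image_univ, mem_ideal_span_X_image, constantCoeff_eq]
  constructor
  · intro h
    by_contra h0
    obtain ⟨i, _, hi⟩ := h 0 (mem_support_iff.mpr h0)
    exact hi rfl
  · intro h a ha
    have : a ≠ 0 := by
      rintro rfl
      exact mem_support_iff.mp ha h
    obtain ⟨i, hi⟩ := Finsupp.ne_iff.mp this
    exact ⟨i, Set.mem_univ _, hi⟩

lemma ofList_map_finRange {R : Type*} [CommRing R] {N : ℕ} (g : Fin N → R) :
    Ideal.ofList ((List.finRange N).map g) = Ideal.span (Set.range g) := by
  refine congrArg Ideal.span (Set.ext fun p ↦ ?_)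
  change p ∈ List.map g _ ↔ _
  simp

/-- Weighted homogeneous polynomials of positive degrees, as many as there are variables, form a
regular sequence as soon as their quotient is finite-dimensional. -/
theorem isWeaklyRegular_of_finiteDimensional {N : ℕ} {w : Fin N → ℕ} (hw : ∀ j, 0 < w j)
    {e : Fin N → ℕ} (he : ∀ i, 0 < e i) {f : Fin N → MvPolynomial (Fin N) k}
    (hhom : ∀ i, (f i).IsWeightedHomogeneous w (e i))
    [FiniteDimensional k (MvPolynomial (Fin N) k ⧸ Ideal.span (Set.range f))] :
    IsWeaklyRegular (MvPolynomial (Fin N) k) ((List.finRange N).map f) := by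
  let P := MvPolynomial (Fin N) k
  let 𝔪 : Ideal P := RingHom.ker (constantCoeff (σ := Fin N) (R := k))
  have : 𝔪.IsPrime := RingHom.ker_isPrime _
  let R := Localization.AtPrime 𝔪
  have h_max : 𝔪.map (algebraMap P R) = IsLocalRing.maximalIdeal R :=
    Localization.AtPrime.map_eq_maximalIdeal
  have mem_max {p : P} (hp : constantCoeff p = 0) :
      algebraMap P R p ∈ IsLocalRing.maximalIdeal R :=
    h_max ▸ Ideal.mem_map_of_mem _ hp
  have h_span : IsWeightedHomogeneousIdeal w (Ideal.span (Set.range f)) :=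
    isWeightedHomogeneousIdeal_span <| by rintro _ ⟨i, rfl⟩; exact ⟨e i, hhom i⟩
  have f_mem (i : Fin N) : constantCoeff (f i) = 0 := by
    rw [constantCoeff_eq]
    exact (hhom i).coeff_eq_zero 0 (by simpa using (he i).ne)
  have reg_X : IsRegular R (((List.finRange N).map (X : Fin N → P)).map (algebraMap P R)) :=
    isWeaklyRegular_X.isRegular_of_isLocalization_of_mem R 𝔪 <| by
      intro p hp
      obtain ⟨i, _, rfl⟩ := List.mem_map.mp hp
      exact constantCoeff_X k i
  have h_rad : IsLocalRing.maximalIdeal R ≤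
      (Ideal.ofList ([] ++ ((List.finRange N).map f).map (algebraMap P R))).radical := by
    rw [List.nil_append, ← Ideal.map_ofList, ofList_map_finRange, ← h_max]
    refine (Ideal.map_mono ?_).trans (Ideal.map_radical_le _)
    intro p hp
    have : Ideal.span (Set.range X) ≤ (Ideal.span (Set.range f)).radical := by
      rw [Ideal.span_le]
      rintro _ ⟨j, rfl⟩
      exact h_span.exists_X_pow_mem hw j
    exact this (mem_span_range_X_iff.mpr hp)
  have reg : IsWeaklyRegular R (((List.finRange N).map f).map (algebraMap P R)) := by
    refine isWeaklyRegular_of_maximalIdeal_le_radical _ ?_ reg_X [] _ (IsWeaklyRegular.nil R R) ?_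
      h_rad (by simp)
    · simp only [List.map_map, List.mem_map]
      rintro _ ⟨i, _, rfl⟩
      exact mem_max (constantCoeff_X k i)
    · simp only [List.map_map, List.mem_map]
      rintro _ ⟨i, _, rfl⟩
      exact mem_max (f_mem i)
  refine ⟨fun i hi ↦ ?_⟩
  have hi' : i < (((List.finRange N).map f).map (algebraMap P R)).length := by simpa using hi
  have h_reg := reg.regular_mod_prev i hi'
  rw [isSMulRegular_iff_right_eq_zero_of_smul] at h_reg ⊢
  intro u hu
  induction u using Submodule.Quotient.induction_on with | _ u
  have h_u := h_reg (Submodule.Quotient.mk (algebraMap P R u))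
  rw [← Submodule.Quotient.mk_smul, Submodule.Quotient.mk_eq_zero, smul_eq_mul, Ideal.mul_top] at hu
  rw [Submodule.Quotient.mk_eq_zero, smul_eq_mul, Ideal.mul_top]
  simp only [← Submodule.Quotient.mk_smul, Submodule.Quotient.mk_eq_zero, smul_eq_mul,
    Ideal.mul_top, List.getElem_map, ← List.map_take, ← Ideal.map_ofList, ← map_mul,
    IsLocalization.algebraMap_mem_map_algebraMap_iff 𝔪.primeCompl] at h_u
  obtain ⟨s, hs, hsu⟩ := h_u ⟨1, 𝔪.primeCompl.one_mem, by simpa using hu⟩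
  rw [← List.map_take]
  refine IsWeightedHomogeneousIdeal.mem_of_mul_mem (isWeightedHomogeneousIdeal_span ?_) hw hs hsu
  intro g hg
  obtain ⟨j, _, rfl⟩ := List.mem_map.mp hg
  exact ⟨e j, hhom j⟩

/-- The degree `m` part of the quotient of the weighted polynomial ring by `I`. -/
noncomputable def quotientPiece (w : σ → ℕ) (I : Ideal (MvPolynomial σ k)) (m : ℕ) :
    Submodule k (MvPolynomial σ k ⧸ I) :=
  Submodule.map (Ideal.Quotient.mkₐ k I).toLinearMap (weightedHomogeneousSubmodule k w m)

/-- The Hilbert series of the quotient of the weighted polynomial ring by `I`. -/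
noncomputable def quotientHilbertSeries (w : σ → ℕ) (I : Ideal (MvPolynomial σ k)) :
    PowerSeries ℤ :=
  PowerSeries.mk fun m ↦ (Module.finrank k (quotientPiece w I m) : ℤ)

lemma finite_quotientPiece [Finite σ] (hw : ∀ j, 0 < w j) (I : Ideal (MvPolynomial σ k)) (m : ℕ) :
    FiniteDimensional k (quotientPiece w I m) := by
  rw [quotientPiece, ← Submodule.fg_iff_finiteDimensional]
  exact (weightedHomogeneousSubmodule_fg k w (fun j ↦ (hw j).ne') m).map _

lemma finrank_quotientPiece_sup_span_singleton [Finite σ] (hw : ∀ j, 0 < w j)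
    {I : Ideal (MvPolynomial σ k)} (hI : IsWeightedHomogeneousIdeal w I) {g : MvPolynomial σ k}
    {e : ℕ} (hg : g.IsWeightedHomogeneous w e)
    (reg : ∀ p, g * p ∈ I → p ∈ I) (m : ℕ) :
    Module.finrank k (quotientPiece w (I ⊔ Ideal.span {g}) m) +
      (if e ≤ m then Module.finrank k (quotientPiece w I (m - e)) else 0) =
    Module.finrank k (quotientPiece w I m) := by
  let J := I ⊔ Ideal.span {g}
  have hIJ : I ≤ J := le_sup_left
  have hgJ : g ∈ J := Ideal.mem_sup_right (Ideal.mem_span_singleton_self g)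
  let F : (MvPolynomial σ k ⧸ I) →ₗ[k] (MvPolynomial σ k ⧸ J) :=
    (Ideal.Quotient.factorₐ k hIJ).toLinearMap
  let G : (MvPolynomial σ k ⧸ I) →ₗ[k] (MvPolynomial σ k ⧸ I) :=
    LinearMap.mulLeft k (Ideal.Quotient.mk I g)
  have hG (p : MvPolynomial σ k) : G (Ideal.Quotient.mk I p) = Ideal.Quotient.mk I (g * p) := rfl
  have G_inj : Function.Injective G := by
    rw [injective_iff_map_eq_zero]
    intro y hy
    obtain ⟨p, rfl⟩ := Ideal.Quotient.mk_surjective y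
    rw [hG, Ideal.Quotient.eq_zero_iff_mem] at hy
    exact Ideal.Quotient.eq_zero_iff_mem.mpr (reg p hy)
  have h_map : (quotientPiece w I m).map F = quotientPiece w J m := by
    rw [quotientPiece, ← Submodule.map_comp]
    rfl
  have h_ker : quotientPiece w I m ⊓ LinearMap.ker F =
      if e ≤ m then (quotientPiece w I (m - e)).map G else ⊥ := by
    apply le_antisymm
    · rintro _ ⟨⟨p, hp, rfl⟩, hpF⟩
      have hpJ : p ∈ J := Ideal.Quotient.eq_zero_iff_mem.mp hpF
      obtain ⟨a, ha, b, hb, rfl⟩ := Submodule.mem_sup.mp hpJ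
      obtain ⟨b, rfl⟩ := Ideal.mem_span_singleton.mp hb
      have h_comp := weightedHomogeneousComponent_eq_self hp
      rw [map_add, hg.weightedHomogeneousComponent_mul] at h_comp
      rw [← h_comp]
      have h_mk : (Ideal.Quotient.mkₐ k I).toLinearMap (weightedHomogeneousComponent w m a) = 0 :=
        Ideal.Quotient.eq_zero_iff_mem.mpr (hI m a ha)
      rw [map_add, h_mk, zero_add]
      split_ifs
      · exact ⟨_, ⟨_, weightedHomogeneousComponent_mem w b _, rfl⟩, rfl⟩
      · simp
    · split_ifs with hem
      · rintro _ ⟨_, ⟨p, hp, rfl⟩, rfl⟩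
        refine ⟨⟨g * p, ?_, rfl⟩, Ideal.Quotient.eq_zero_iff_mem.mpr (J.mul_mem_right p hgJ)⟩
        have := hg.mul hp
        rwa [Nat.add_sub_cancel' hem] at this
      · exact bot_le
  have := finite_quotientPiece hw I m
  have h_rank := LinearMap.finrank_range_add_finrank_ker (F.domRestrict (quotientPiece w I m))
  rw [LinearMap.range_domRestrict, h_map, LinearMap.ker_domRestrict,
    ← Submodule.finrank_map_subtype_eq, Submodule.map_comap_subtype, h_ker] at h_rank
  rw [← h_rank]
  congr 1
  by_cases hem : e ≤ m
  · rw [if_pos hem, if_pos hem]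
    exact (Submodule.equivMapOfInjective G G_inj (quotientPiece w I (m - e))).finrank_eq
  · rw [if_neg hem, if_neg hem, finrank_bot]

lemma quotientHilbertSeries_sup_span_singleton [Finite σ] (hw : ∀ j, 0 < w j)
    {I : Ideal (MvPolynomial σ k)} (hI : IsWeightedHomogeneousIdeal w I) {g : MvPolynomial σ k}
    {e : ℕ} (hg : g.IsWeightedHomogeneous w e) (reg : ∀ p, g * p ∈ I → p ∈ I) :
    quotientHilbertSeries w (I ⊔ Ideal.span {g}) =
      (1 - PowerSeries.X ^ e) * quotientHilbertSeries w I := by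
  ext m
  have h := finrank_quotientPiece_sup_span_singleton hw hI hg reg m
  rw [sub_mul, one_mul, map_sub, PowerSeries.coeff_X_pow_mul']
  simp only [quotientHilbertSeries, PowerSeries.coeff_mk]
  rw [← h]
  split_ifs <;> simp

lemma quotientHilbertSeries_of_isWeaklyRegular [Finite σ] (hw : ∀ j, 0 < w j) {ι : Type*}
    {f : ι → MvPolynomial σ k} {e : ι → ℕ} (hhom : ∀ i, (f i).IsWeightedHomogeneous w (e i))
    (l : List ι) (reg : IsWeaklyRegular (MvPolynomial σ k) (l.map f)) :
    quotientHilbertSeries w (Ideal.ofList (l.map f)) =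
      (l.map fun i ↦ 1 - (PowerSeries.X : PowerSeries ℤ) ^ e i).prod *
        quotientHilbertSeries w (⊥ : Ideal (MvPolynomial σ k)) := by
  induction l using List.reverseRecOn with
  | nil => simp
  | append_singleton l i ih =>
    rw [List.map_append, List.map_singleton, isWeaklyRegular_append_iff,
      isWeaklyRegular_singleton_iff, isSMulRegular_iff_right_eq_zero_of_smul] at reg
    rw [List.map_append, List.map_singleton, Ideal.ofList_append, Ideal.ofList_singleton,
      quotientHilbertSeries_sup_span_singleton hw (isWeightedHomogeneousIdeal_span ?_) (hhom i) ?_,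
      ih reg.1, List.map_append, List.prod_append]
    · simp only [List.map_singleton, List.prod_singleton]
      ring
    · rintro _ hg
      obtain ⟨j, _, rfl⟩ := List.mem_map.mp hg
      exact ⟨e j, hhom j⟩
    · intro p hp
      have := reg.2 (Submodule.Quotient.mk p)
      rw [← Submodule.Quotient.mk_smul, Submodule.Quotient.mk_eq_zero,
        Submodule.Quotient.mk_eq_zero] at this
      simp only [smul_eq_mul, Ideal.mul_top] at this
      exact this hp

lemma quotientHilbertSeries_span_range_X (hw : ∀ j, 0 < w j) :
    quotientHilbertSeries w (Ideal.span (Set.range (X : σ → MvPolynomial σ k))) = 1 := by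
  ext m
  rw [quotientHilbertSeries, PowerSeries.coeff_mk, PowerSeries.coeff_one]
  split_ifs with hm
  · subst hm
    have : quotientPiece w (Ideal.span (Set.range (X : σ → MvPolynomial σ k))) 0 =
        Submodule.span k {1} := by
      apply le_antisymm
      · rintro _ ⟨p, hp, rfl⟩
        rw [Submodule.mem_span_singleton]
        refine ⟨constantCoeff p, ?_⟩
        rw [← weightedHomogeneousComponent_eq_self hp,
          weightedHomogeneousComponent_zero p (fun j ↦ (hw j).ne'), ← constantCoeff_eq,
          constantCoeff_C, ← mul_one (C _), ← smul_eq_C_mul, map_smul]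
        exact congrArg _ (map_one (Ideal.Quotient.mk _)).symm
      · rw [Submodule.span_singleton_le_iff_mem]
        exact ⟨1, isWeightedHomogeneous_one k w, map_one (Ideal.Quotient.mk _)⟩
    rw [this, finrank_span_singleton, Nat.cast_one]
    intro h
    have h_one := mem_span_range_X_iff.mp
      (Ideal.Quotient.eq_zero_iff_mem.mp ((map_one (Ideal.Quotient.mk _)).trans h))
    simp at h_one
  · have : quotientPiece w (Ideal.span (Set.range (X : σ → MvPolynomial σ k))) m = ⊥ := by
      rw [eq_bot_iff]
      rintro _ ⟨p, hp, rfl⟩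
      refine Ideal.Quotient.eq_zero_iff_mem.mpr (mem_span_range_X_iff.mpr ?_)
      rw [constantCoeff_eq]
      exact IsWeightedHomogeneous.coeff_eq_zero hp 0 (by simpa using Ne.symm hm)
    rw [this, finrank_bot, Nat.cast_zero]

/-- The Hilbert series of a weighted homogeneous complete intersection of dimension zero. -/
theorem quotientHilbertSeries_mul_prod {N : ℕ} {w : Fin N → ℕ} (hw : ∀ j, 0 < w j)
    {e : Fin N → ℕ} {f : Fin N → MvPolynomial (Fin N) k} (hf : ∀ i, f i ≠ 0)
    (hhom : ∀ i, (f i).IsWeightedHomogeneous w (e i))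
    [FiniteDimensional k (MvPolynomial (Fin N) k ⧸ Ideal.span (Set.range f))] :
    quotientHilbertSeries w (Ideal.span (Set.range f)) *
        ∏ j, (1 - (PowerSeries.X : PowerSeries ℤ) ^ w j) =
      ∏ i, (1 - (PowerSeries.X : PowerSeries ℤ) ^ e i) := by
  by_cases he : ∀ i, 0 < e i
  · have h_f := quotientHilbertSeries_of_isWeaklyRegular hw hhom _
      (isWeaklyRegular_of_finiteDimensional hw he hhom)
    have h_X := quotientHilbertSeries_of_isWeaklyRegular hw (isWeightedHomogeneous_X k w) _
      isWeaklyRegular_X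
    rw [ofList_map_finRange, ← Fin.prod_univ_def] at h_f h_X
    rw [quotientHilbertSeries_span_range_X hw] at h_X
    rw [h_f, mul_assoc, mul_comm (quotientHilbertSeries _ _), ← h_X, mul_one]
  · push Not at he
    obtain ⟨i, hi⟩ := he
    have h_top : Ideal.span (Set.range f) = ⊤ := by
      have h_i := hhom i
      rw [Nat.le_zero.mp hi] at h_i
      have h_C := weightedHomogeneousComponent_eq_self h_i
      rw [weightedHomogeneousComponent_zero _ fun j ↦ (hw j).ne'] at h_C
      refine Ideal.eq_top_of_isUnit_mem _ (Ideal.subset_span ⟨i, rfl⟩) ?_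
      rw [← h_C]
      refine (IsUnit.mk0 _ fun h ↦ hf i ?_).map C
      rw [← h_C, h, map_zero]
    have h_series : quotientHilbertSeries w (Ideal.span (Set.range f)) = 0 := by
      have := Ideal.Quotient.subsingleton_iff.mpr h_top
      ext m
      rw [quotientHilbertSeries, PowerSeries.coeff_mk, map_zero, Nat.cast_eq_zero]
      exact Module.finrank_zero_of_subsingleton
    rw [h_series, zero_mul, Finset.prod_eq_zero (Finset.mem_univ i)]
    rw [Nat.le_zero.mp hi, pow_zero, sub_self]

/-- A finite-dimensional weighted homogeneous quotient vanishes in large degrees. -/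
lemma IsWeightedHomogeneousIdeal.exists_quotientPiece_eq_bot [Fintype σ]
    {I : Ideal (MvPolynomial σ k)} (hI : IsWeightedHomogeneousIdeal w I) (hw : ∀ j, 0 < w j)
    [FiniteDimensional k (MvPolynomial σ k ⧸ I)] :
    ∃ B, ∀ m, B < m → quotientPiece w I m = ⊥ := by
  choose n hn using hI.exists_X_pow_mem hw
  refine ⟨∑ j, n j * w j, fun m hm ↦ ?_⟩
  rw [eq_bot_iff]
  rintro _ ⟨p, hp, rfl⟩
  refine Ideal.Quotient.eq_zero_iff_mem.mpr ?_
  rw [p.as_sum]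
  refine Ideal.sum_mem _ fun d hd ↦ ?_
  obtain ⟨j, hj⟩ : ∃ j, n j ≤ d j := by
    by_contra! h
    refine hm.not_ge ?_
    rw [← hp (mem_support_iff.mp hd), Finsupp.weight_apply, Finsupp.sum_fintype _ _ (by simp)]
    exact Finset.sum_le_sum fun j _ ↦ Nat.mul_le_mul_right _ (h j).le
  refine I.mem_of_dvd ?_ (hn j)
  rw [X_pow_eq_monomial, monomial_dvd_monomial]
  exact ⟨Or.inr (Finsupp.single_le_iff.mpr hj), one_dvd _⟩

end MvPolynomial

/-- the Hilbert series identity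
`(∑ₘ dim_ℂ(A_m) tᵐ) · ∏ⱼ (1 − t^{wⱼ}) = ∏ᵢ (1 − t^{eᵢ})` in `ℤ[[t]]`; in particular
`∏ᵢ(1 − t^{eᵢ}) / ∏ⱼ(1 − t^{wⱼ})` is a polynomial with nonnegative integer coefficients. -/
theorem stmt13 (N : ℕ) (hN : 1 ≤ N) (w : Fin N → ℕ) (hw : ∀ j, 0 < w j)
    (e : Fin N → ℕ) (f : Fin N → MvPolynomial (Fin N) ℂ)
    (hf : ∀ i, f i ≠ 0)
    (hhom : ∀ i, (f i).IsWeightedHomogeneous w (e i))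
    (hfin : FiniteDimensional ℂ (MvPolynomial (Fin N) ℂ ⧸ Ideal.span (Set.range f))) :
    (PowerSeries.mk fun m => (Module.finrank ℂ (gradedPiece N w f m) : ℤ)) *
        ∏ j, (1 - (PowerSeries.X : PowerSeries ℤ) ^ (w j))
      = ∏ i, (1 - (PowerSeries.X : PowerSeries ℤ) ^ (e i)) ∧
    ∃ p : Polynomial ℕ,
      (PowerSeries.mk fun m => (p.coeff m : ℤ)) *
          ∏ j, (1 - (PowerSeries.X : PowerSeries ℤ) ^ (w j))
        = ∏ i, (1 - (PowerSeries.X : PowerSeries ℤ) ^ (e i)) := by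
  have h_series : (PowerSeries.mk fun m => (Module.finrank ℂ (gradedPiece N w f m) : ℤ)) *
      ∏ j, (1 - (PowerSeries.X : PowerSeries ℤ) ^ (w j)) =
        ∏ i, (1 - (PowerSeries.X : PowerSeries ℤ) ^ (e i)) :=
    MvPolynomial.quotientHilbertSeries_mul_prod hw hf hhom
  have hI : MvPolynomial.IsWeightedHomogeneousIdeal w (Ideal.span (Set.range f)) :=
    MvPolynomial.isWeightedHomogeneousIdeal_span <| by rintro _ ⟨i, rfl⟩; exact ⟨e i, hhom i⟩
  obtain ⟨B, hB⟩ := hI.exists_quotientPiece_eq_bot hw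
  refine ⟨h_series, ∑ m ∈ Finset.range (B + 1),
    Polynomial.monomial m (Module.finrank ℂ (gradedPiece N w f m)), ?_⟩
  rw [← h_series]
  congr 1
  ext m
  rw [PowerSeries.coeff_mk, PowerSeries.coeff_mk, Polynomial.finsetSum_coeff]
  simp only [Polynomial.coeff_monomial, Finset.sum_ite_eq', Finset.mem_range]
  split_ifs with hm
  · rfl
  · have : gradedPiece N w f m = ⊥ := hB m (by omega)
    rw [this, finrank_bot]
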